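/- arXiv:1901.09441 — 3 statements merged into one kernel-verified Lean document; each statement's English description precedes it below -/
import Mathlib

section
/- Every twist G⁽⁰⁾×𝕋 →ᶦ Σ →ʲ G over a σ-compact ample locally compact Hausdorff groupoid G is continuous: there exists a global continuous section s : G → Σ with j(s(g)) = g for all g ∈ G. -/
set_option autoImplicit false

/-- A topological groupoid: a set `G` with a set of composable pairs (given by the relation
`comp`), a partially defined multiplication (encoded as a total function `mul`, whose values
only matter on composable pairs), and an involutive inverse, equipped with a topology making
multiplication (on the set of composable pairs) and inversion continuous. -/
structure TopGroupoid (G : Type*) [TopologicalSpace G] where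
  comp : G → G → Prop
  mul : G → G → G
  inv : G → G
  comp_mul_left : ∀ {g h k : G}, comp g h → comp h k → comp (mul g h) k
  comp_mul_right : ∀ {g h k : G}, comp g h → comp h k → comp g (mul h k)
  mul_assoc' : ∀ {g h k : G}, comp g h → comp h k → mul (mul g h) k = mul g (mul h k)
  inv_inv' : ∀ g : G, inv (inv g) = g
  comp_inv' : ∀ g : G, comp g (inv g)
  comp_inv_mul : ∀ {g h : G}, comp g h → comp (inv g) (mul g h)
  inv_mul_cancel' : ∀ {g h : G}, comp g h → mul (inv g) (mul g h) = h
  comp_mul_inv : ∀ {g h : G}, comp g h → comp (mul g h) (inv h)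
  mul_inv_cancel' : ∀ {g h : G}, comp g h → mul (mul g h) (inv h) = g
  continuous_mul : ContinuousOn (fun p : G × G => mul p.1 p.2) {p : G × G | comp p.1 p.2}
  continuous_inv : Continuous inv

namespace TopGroupoid

variable {G : Type*} [TopologicalSpace G] (S : TopGroupoid G)

/-- The set of units `G⁽⁰⁾ = {g : g = g⁻¹ = g²}`. -/
def unitSet : Set G := {g | S.comp g g ∧ S.inv g = g ∧ S.mul g g = g}

/-- The domain map `d(g) = g⁻¹g`. -/
def d (g : G) : G := S.mul (S.inv g) g

/-- The range map `r(g) = gg⁻¹`. -/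
def r (g : G) : G := S.mul g (S.inv g)

/-- A topological groupoid is étale if its domain map is a local homeomorphism. -/
def IsEtale : Prop := IsLocalHomeomorph S.d

/-- A topological groupoid is ample if it is étale and its unit space is totally
disconnected. -/
def IsAmple : Prop := S.IsEtale ∧ IsTotallyDisconnected S.unitSet

end TopGroupoid

/-- A twist `G⁽⁰⁾ × 𝕋 → Σ → G` over a topological groupoid `G`: a central extension of
topological groupoids, where `i` is a homeomorphism onto `j⁻¹(G⁽⁰⁾)`, `j` is a continuous open
surjection, both are groupoid homomorphisms, and the extension is central. The unit space of
`Σ` is identified with `G⁽⁰⁾` via `j`. -/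
structure Twist {G Sg : Type*} [TopologicalSpace G] [TopologicalSpace Sg]
    (SG : TopGroupoid G) (SS : TopGroupoid Sg) where
  i : ↥SG.unitSet × Circle → Sg
  j : Sg → G
  continuous_i : Continuous i
  isEmbedding_i : Topology.IsEmbedding i
  range_i : Set.range i = j ⁻¹' SG.unitSet
  i_comp : ∀ (u : ↥SG.unitSet) (z w : Circle), SS.comp (i (u, z)) (i (u, w))
  i_mul : ∀ (u : ↥SG.unitSet) (z w : Circle), SS.mul (i (u, z)) (i (u, w)) = i (u, z * w)
  i_inv : ∀ (u : ↥SG.unitSet) (z : Circle), SS.inv (i (u, z)) = i (u, z⁻¹)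
  continuous_j : Continuous j
  isOpenMap_j : IsOpenMap j
  surjective_j : Function.Surjective j
  j_comp : ∀ {σ τ : Sg}, SS.comp σ τ → SG.comp (j σ) (j τ)
  j_mul : ∀ {σ τ : Sg}, SS.comp σ τ → j (SS.mul σ τ) = SG.mul (j σ) (j τ)
  j_inv : ∀ σ : Sg, j (SS.inv σ) = SG.inv (j σ)
  j_i : ∀ (u : ↥SG.unitSet) (z : Circle), j (i (u, z)) = (u : G)
  j_r_unit : ∀ σ : Sg, j (SS.r σ) ∈ SG.unitSet
  j_d_unit : ∀ σ : Sg, j (SS.d σ) ∈ SG.unitSet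
  comp_central : ∀ (σ : Sg) (z : Circle),
    SS.comp (i (⟨j (SS.r σ), j_r_unit σ⟩, z)) σ ∧ SS.comp σ (i (⟨j (SS.d σ), j_d_unit σ⟩, z))
  central : ∀ (σ : Sg) (z : Circle),
    SS.mul (i (⟨j (SS.r σ), j_r_unit σ⟩, z)) σ = SS.mul σ (i (⟨j (SS.d σ), j_d_unit σ⟩, z))

/-- The canonical action of the circle `𝕋` on a twist: `z • σ := i(r(σ), z)σ`. -/
def Twist.smul {G Sg : Type*} [TopologicalSpace G] [TopologicalSpace Sg]
    {SG : TopGroupoid G} {SS : TopGroupoid Sg} (T : Twist SG SS) (z : Circle) (σ : Sg) : Sg :=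
  SS.mul (T.i (⟨T.j (SS.r σ), T.j_r_unit σ⟩, z)) σ

namespace TopGroupoid

variable {G : Type*} [TopologicalSpace G] (S : TopGroupoid G)

lemma comp_inv_self (g : G) : S.comp (S.inv g) g := by
  have := S.comp_inv' (S.inv g)
  rwa [S.inv_inv'] at this

lemma r_mul (g : G) : S.mul (S.r g) g = g := by
  have := S.mul_inv_cancel' (S.comp_inv' g)
  rwa [S.inv_inv'] at this

lemma mul_d (g : G) : S.mul g (S.d g) = g := by
  have := S.inv_mul_cancel' (S.comp_inv_self g)
  rwa [S.inv_inv'] at this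

lemma comp_r (g : G) : S.comp (S.r g) g := S.comp_mul_left (S.comp_inv' g) (S.comp_inv_self g)

lemma comp_d (g : G) : S.comp g (S.d g) := S.comp_mul_right (S.comp_inv' g) (S.comp_inv_self g)

lemma unit_of_idem {e : G} (h : S.comp e e) (h2 : S.mul e e = e) : e ∈ S.unitSet := by
  refine ⟨h, ?_, h2⟩
  have h3 := S.inv_mul_cancel' h
  have h4 := S.mul_inv_cancel' h
  have h5 := S.mul_inv_cancel' (S.comp_inv_self e)
  rw [h2] at h3 h4
  rw [h3] at h5
  rw [← h5, h4]

lemma r_comp_r (g : G) : S.comp (S.r g) (S.r g) := S.comp_mul_right (S.comp_r g) (S.comp_inv' g)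

lemma r_idem (g : G) : S.mul (S.r g) (S.r g) = S.r g := by
  have := S.mul_assoc' (S.comp_r g) (S.comp_inv' g)
  rw [S.r_mul] at this
  exact this.symm

lemma r_mem (g : G) : S.r g ∈ S.unitSet := S.unit_of_idem (S.r_comp_r g) (S.r_idem g)

lemma d_eq (g : G) : S.d g = S.r (S.inv g) := by simp [d, r, S.inv_inv']

lemma d_mem (g : G) : S.d g ∈ S.unitSet := by rw [d_eq]; exact S.r_mem _

lemma comp_of {g h : G} (e : S.d g = S.r h) : S.comp g h := by
  have h1 := S.comp_d g
  have h2 := S.comp_r h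
  rw [← e] at h2
  have := S.comp_mul_left h1 h2
  rwa [S.mul_d] at this

lemma continuous_r : Continuous S.r :=
  S.continuous_mul.comp_continuous (continuous_id.prodMk S.continuous_inv) (fun g => S.comp_inv' g)

lemma totallyDisconnected [T2Space G] (h : S.IsAmple) : TotallyDisconnectedSpace G := by
  obtain ⟨he, hd⟩ := h
  refine ⟨fun X _ hX x hx y hy => ?_⟩
  have hsub : (S.d '' X).Subsingleton :=
    hd _ (by rintro _ ⟨g, _, rfl⟩; exact S.d_mem g) (hX.image _ he.continuous.continuousOn)
  obtain ⟨e, hxe, hee⟩ := he x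
  by_contra hne
  have := hX e.source {x}ᶜ e.open_source isOpen_compl_singleton
    (fun z _ => by
      by_cases hz : z = x
      · left; rwa [hz]
      · right; exact hz)
    ⟨x, hx, hxe⟩ ⟨y, hy, fun h => hne h.symm⟩
  obtain ⟨z, hzX, hze, hzx⟩ := this
  apply hzx
  apply e.injOn hze hxe
  rw [← hee]
  exact hsub ⟨z, hzX, rfl⟩ ⟨x, hx, rfl⟩

end TopGroupoid

namespace Twist

variable {G Sg : Type*} [TopologicalSpace G] [TopologicalSpace Sg]
    {SG : TopGroupoid G} {SS : TopGroupoid Sg} (T : Twist SG SS)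

lemma j_r (σ : Sg) : T.j (SS.r σ) = SG.r (T.j σ) := by
  unfold TopGroupoid.r
  rw [T.j_mul (SS.comp_inv' σ), T.j_inv]

lemma r_eq (σ : Sg) : SS.r σ = T.i (⟨T.j (SS.r σ), T.j_r_unit σ⟩, 1) := by
  have hm : SS.r σ ∈ Set.range T.i := by rw [T.range_i]; exact T.j_r_unit σ
  obtain ⟨⟨u, z⟩, h⟩ := hm
  have h2 := SS.r_idem σ
  rw [← h, T.i_mul] at h2
  have h3 := T.isEmbedding_i.injective h2
  have hz : z = 1 := by
    have := congrArg Prod.snd h3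
    simpa using this
  subst hz
  have hu : (⟨T.j (SS.r σ), T.j_r_unit σ⟩ : SG.unitSet) = u := by
    apply Subtype.ext
    simp only [← h, T.j_i]
  rw [hu, h]

lemma r_eq_of_j {σ τ : Sg} (h : T.j σ = T.j τ) : SS.r σ = SS.r τ := by
  rw [T.r_eq σ, T.r_eq τ]
  congr 2
  apply Subtype.ext
  simp only [T.j_r, h]

lemma j_smul (z : Circle) (σ : Sg) : T.j (T.smul z σ) = T.j σ := by
  unfold smul
  rw [T.j_mul (T.comp_central σ z).1, T.j_i]
  simp only [T.j_r]
  exact SG.r_mul _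

lemma one_smul' (σ : Sg) : T.smul 1 σ = σ := by
  unfold smul
  rw [← T.r_eq, SS.r_mul]

lemma smul_smul' (z w : Circle) (σ : Sg) : T.smul z (T.smul w σ) = T.smul (z * w) σ := by
  have hr : (⟨T.j (SS.r (T.smul w σ)), T.j_r_unit _⟩ : SG.unitSet) =
      ⟨T.j (SS.r σ), T.j_r_unit σ⟩ := by
    apply Subtype.ext
    simp only [T.j_r, T.j_smul]
  have : T.smul z (T.smul w σ) =
      SS.mul (T.i (⟨T.j (SS.r (T.smul w σ)), T.j_r_unit _⟩, z)) (T.smul w σ) := rfl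
  rw [this, hr]
  unfold smul
  rw [← SS.mul_assoc' (T.i_comp _ _ _) (T.comp_central σ w).1, T.i_mul]

lemma smul_inj (σ : Sg) {z w : Circle} (h : T.smul z σ = T.smul w σ) : z = w := by
  unfold smul at h
  have h1 := SS.mul_inv_cancel' (T.comp_central σ z).1
  have h2 := SS.mul_inv_cancel' (T.comp_central σ w).1
  rw [h, h2] at h1
  exact (congrArg Prod.snd (T.isEmbedding_i.injective h1)).symm

lemma exists_smul {σ τ : Sg} (h : T.j σ = T.j τ) : ∃ z, τ = T.smul z σ := by
  have hinv : T.j (SS.inv τ) = T.j (SS.inv σ) := by rw [T.j_inv, T.j_inv, h]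
  have hc : SS.comp τ (SS.inv σ) := by
    apply SS.comp_of
    rw [SS.d_eq]
    exact T.r_eq_of_j hinv
  have hj : T.j (SS.mul τ (SS.inv σ)) = T.j (SS.r σ) := by
    rw [T.j_mul hc, T.j_r, T.j_inv, h]
    rfl
  have hm : SS.mul τ (SS.inv σ) ∈ Set.range T.i := by
    rw [T.range_i, Set.mem_preimage, hj]; exact T.j_r_unit σ
  obtain ⟨⟨u, z⟩, hu⟩ := hm
  have hu' : u = ⟨T.j (SS.r σ), T.j_r_unit σ⟩ := by
    apply Subtype.ext
    rw [← T.j_i u z, hu, hj]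
  refine ⟨z, ?_⟩
  unfold smul
  rw [← hu', hu]
  have := SS.mul_inv_cancel' hc
  rw [SS.inv_inv'] at this
  exact this.symm

lemma continuous_smul' : Continuous (fun p : Circle × Sg => T.smul p.1 p.2) := by
  unfold smul
  refine SS.continuous_mul.comp_continuous
    (f := fun p : Circle × Sg => (T.i (⟨T.j (SS.r p.2), T.j_r_unit p.2⟩, p.1), p.2)) ?_
    (fun p => (T.comp_central p.2 p.1).1)
  refine Continuous.prodMk (T.continuous_i.comp (Continuous.prodMk ?_ continuous_fst))
    continuous_snd
  exact Continuous.subtype_mk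
    (T.continuous_j.comp (SS.continuous_r.comp continuous_snd)) _

open Topology MeasureTheory in
/-- An equivariant function which does not vanish at a given point. -/
lemma exists_equivariant [LocallyCompactSpace Sg] [T2Space Sg] (σ₀ : Sg) :
    ∃ F : Sg → ℂ, Continuous F ∧ F σ₀ ≠ 0 ∧ ∀ (w : Circle) (σ : Sg),
      F (T.smul w σ) = w * F σ := by
  classical
  have horb : Continuous (fun z : Circle => T.smul z σ₀) :=
    T.continuous_smul'.comp (continuous_id.prodMk continuous_const)
  let A : Set Sg := (fun z : Circle => T.smul z σ₀) '' {z : Circle | (z : ℂ).re ≤ 0}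
  have hA : IsClosed A := by
    apply IsCompact.isClosed
    apply IsCompact.image _ horb
    apply IsClosed.isCompact
    exact isClosed_le (Complex.continuous_re.comp continuous_subtype_val) continuous_const
  have hσA : σ₀ ∉ A := by
    rintro ⟨z, hz, hzz⟩
    have : z = 1 := T.smul_inj σ₀ (hzz.trans (T.one_smul' σ₀).symm)
    subst this
    simp at hz
    linarith
  obtain ⟨f, hf0, hfA, hf01⟩ := exists_continuous_zero_one_of_isCompact
    (isCompact_singleton (x := σ₀)) hA (Set.disjoint_singleton_left.2 hσA)
  replace hf0 : f σ₀ = 0 := hf0 rfl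
  letI : MeasurableSpace Circle := borel Circle
  haveI : BorelSpace Circle := ⟨rfl⟩
  let μ : Measure Circle := Measure.haar
  let g : Sg → ℝ := fun σ => 1 - f σ
  have hg : Continuous g := continuous_const.sub f.continuous
  let F : Sg → ℂ := fun σ => ∫ z : Circle, ((z⁻¹ : Circle) : ℂ) * (g (T.smul z σ) : ℂ) ∂μ
  have hint : Continuous (fun p : Sg × Circle =>
      ((p.2⁻¹ : Circle) : ℂ) * (g (T.smul p.2 p.1) : ℂ)) := by
    have hc : Continuous (fun z : Circle => (z : ℂ)) := continuous_subtype_val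
    have hi : Continuous (fun p : Sg × Circle => (p.2⁻¹ : Circle)) := continuous_snd.inv
    refine Continuous.mul (hc.comp hi) ?_
    exact Complex.continuous_ofReal.comp (hg.comp (T.continuous_smul'.comp continuous_swap))
  refine ⟨F, ?_, ?_, ?_⟩
  · rw [← continuousOn_univ]
    exact continuousOn_integral_of_compact_support (k := Set.univ) isCompact_univ
      hint.continuousOn (fun p x _ hx => absurd (Set.mem_univ x) hx)
  · have hi : Continuous (fun z : Circle => ((z⁻¹ : Circle) : ℂ) * (g (T.smul z σ₀) : ℂ)) :=
      hint.comp (continuous_const.prodMk continuous_id)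
    have hre : (F σ₀).re = ∫ z : Circle, (((z⁻¹ : Circle) : ℂ) * (g (T.smul z σ₀) : ℂ)).re ∂μ := by
      have hI : Integrable (fun z : Circle => ((z⁻¹ : Circle) : ℂ) * (g (T.smul z σ₀) : ℂ)) μ :=
        hi.integrable_of_hasCompactSupport (HasCompactSupport.of_compactSpace _)
      exact (integral_re hI).symm
    have hpos : 0 < ∫ z : Circle, (((z⁻¹ : Circle) : ℂ) * (g (T.smul z σ₀) : ℂ)).re ∂μ := by
      apply Continuous.integral_pos_of_hasCompactSupport_nonneg_nonzero (x := 1)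
        (Complex.continuous_re.comp hi) (HasCompactSupport.of_compactSpace _)
      · intro z
        have hz : (((z⁻¹ : Circle) : ℂ) * (g (T.smul z σ₀) : ℂ)).re
            = (z : ℂ).re * g (T.smul z σ₀) := by
          rw [Complex.re_mul_ofReal, Circle.coe_inv_eq_conj, Complex.conj_re]
        change 0 ≤ (((z⁻¹ : Circle) : ℂ) * (g (T.smul z σ₀) : ℂ)).re
        rw [hz]
        rcases le_or_gt (z : ℂ).re 0 with h | h
        · have : f (T.smul z σ₀) = 1 := hfA ⟨z, h, rfl⟩
          simp [g, this]
        · exact mul_nonneg h.le (sub_nonneg.2 (hf01 _).2)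
      · simp [g, T.one_smul', hf0]
    intro h0
    rw [h0] at hre
    simp only [Complex.zero_re] at hre
    linarith
  · intro w σ
    have h1 := integral_mul_right_eq_self (μ := μ)
      (fun z : Circle => ((z⁻¹ : Circle) : ℂ) * (g (T.smul z σ) : ℂ)) w
    change _ = (w : ℂ) * ∫ z : Circle, ((z⁻¹ : Circle) : ℂ) * (g (T.smul z σ) : ℂ) ∂μ
    rw [← h1, ← integral_const_mul]
    apply integral_congr_ae
    refine Filter.Eventually.of_forall (fun z => ?_)
    simp only [T.smul_smul']
    have hw : (w : ℂ) ≠ 0 := Circle.coe_ne_zero w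
    have hz : (z : ℂ) ≠ 0 := Circle.coe_ne_zero z
    push_cast
    field_simp

open Classical in
/-- The phase of a complex number. -/
noncomputable def phase (c : ℂ) : Circle :=
  if h : c ≠ 0 then ⟨c / ‖c‖, by
    have : ‖c‖ ≠ 0 := norm_ne_zero_iff.2 h
    apply mem_sphere_zero_iff_norm.2
    simp [this]⟩ else 1

lemma coe_phase {c : ℂ} (h : c ≠ 0) : ((phase c : Circle) : ℂ) = c / ‖c‖ := by
  have : phase c = _ := dif_pos h
  rw [this]

lemma continuousAt_phase {c : ℂ} (h : c ≠ 0) : ContinuousAt phase c := by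
  apply Topology.IsInducing.subtypeVal.continuousAt_iff.2
  have h1 : ContinuousAt (fun c : ℂ => c / (‖c‖ : ℂ)) c := by
    refine continuousAt_id.div (Complex.continuous_ofReal.comp continuous_norm).continuousAt ?_
    simpa using h
  refine h1.congr ?_
  filter_upwards [isOpen_ne.mem_nhds h] with x hx
  exact (coe_phase hx).symm

lemma phase_mul (w : Circle) {c : ℂ} (h : c ≠ 0) : phase (w * c) = w * phase c := by
  apply Circle.ext
  rw [Circle.coe_mul, coe_phase h, coe_phase (mul_ne_zero (Circle.coe_ne_zero w) h)]
  rw [norm_mul, Circle.norm_coe, one_mul, mul_div_assoc]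

open Topology in
/-- Local sections exist. -/
lemma exists_local_section [LocallyCompactSpace Sg] [T2Space Sg] (g₀ : G) :
    ∃ W : Set G, IsOpen W ∧ g₀ ∈ W ∧ ∃ s : G → Sg, ContinuousOn s W ∧
      ∀ g, T.j (s g) = g := by
  classical
  obtain ⟨σ₀, hσ₀⟩ := T.surjective_j g₀
  obtain ⟨F, hF, hF0, hFe⟩ := T.exists_equivariant σ₀
  let q : Sg → Sg := fun σ => T.smul (phase (F σ))⁻¹ σ
  have hV : IsOpen {σ | F σ ≠ 0} := isOpen_ne_fun hF continuous_const
  have hq : ∀ σ τ, T.j σ = T.j τ → F σ ≠ 0 → q τ = q σ := by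
    intro σ τ h h0
    obtain ⟨z, rfl⟩ := T.exists_smul h
    simp only [q, hFe, phase_mul z h0, T.smul_smul']
    congr 1
    simp
  refine ⟨T.j '' {σ | F σ ≠ 0}, T.isOpenMap_j _ hV, ⟨σ₀, hF0, hσ₀⟩,
    fun g => q (Function.surjInv T.surjective_j g), ?_, ?_⟩
  · rintro _ ⟨σ, hσ, rfl⟩
    apply ContinuousAt.continuousWithinAt
    unfold ContinuousAt
    rw [← T.isOpenMap_j.map_nhds_eq T.continuous_j.continuousAt, Filter.tendsto_map'_iff]
    beta_reduce
    rw [hq σ _ (Function.surjInv_eq T.surjective_j _).symm hσ]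
    have hqc : ContinuousAt q σ := by
      have h1 : ContinuousAt (fun σ => (phase (F σ))⁻¹) σ :=
        ((continuousAt_phase hσ).comp hF.continuousAt).inv
      exact T.continuous_smul'.continuousAt.comp (h1.prodMk continuousAt_id)
    refine Filter.Tendsto.congr' ?_ hqc
    filter_upwards [hV.mem_nhds hσ] with τ hτ
    exact (hq τ _ (Function.surjInv_eq T.surjective_j _).symm hτ).symm
  · intro g
    simp only [q, T.j_smul]
    exact Function.surjInv_eq T.surjective_j g

end Twist

/-- Every twist over a σ-compact ample locally compact Hausdorff groupoid is
continuous: there is a global continuous section `s : G → Σ` with `j(s(g)) = g` for all `g`. -/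
theorem twist_global_section_of_ample {G Sg : Type*} [TopologicalSpace G]
    [LocallyCompactSpace G] [T2Space G] [SigmaCompactSpace G]
    [TopologicalSpace Sg] [LocallyCompactSpace Sg] [T2Space Sg]
    (SG : TopGroupoid G) (hG : SG.IsAmple) (SS : TopGroupoid Sg) (T : Twist SG SS) :
    ∃ s : G → Sg, Continuous s ∧ ∀ g : G, T.j (s g) = g := by
  classical
  haveI := SG.totallyDisconnected hG
  have key : ∀ g : G, ∃ U : Set G, IsClopen U ∧ g ∈ U ∧ ∃ s : G → Sg, ContinuousOn s U ∧
      ∀ g, T.j (s g) = g := by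
    intro g
    obtain ⟨W, hW, hgW, s, hs, hsj⟩ := T.exists_local_section g
    obtain ⟨U, hU, hgU, hUW⟩ :=
      (loc_compact_Haus_tot_disc_of_zero_dim (H := G)).exists_subset_of_mem_open hgW hW
    exact ⟨U, hU, hgU, s, hs.mono hUW, hsj⟩
  choose U hU hgU s hs hsj using key
  obtain ⟨t, htc, htU⟩ := LindelofSpace.elim_nhds_subcover U
    (fun g => (hU g).isOpen.mem_nhds (hgU g))
  rcases isEmpty_or_nonempty G with hE | hN
  · exact ⟨fun g => hE.elim g, continuous_of_const (fun g => hE.elim g), fun g => hE.elim g⟩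
  have htn : t.Nonempty := by
    obtain ⟨g⟩ := hN
    have : g ∈ ⋃ x ∈ t, U x := by rw [htU]; trivial
    simp only [Set.mem_iUnion] at this
    obtain ⟨x, hx, _⟩ := this
    exact ⟨x, hx⟩
  obtain ⟨e, he⟩ := htc.exists_eq_range htn
  have hcov : ∀ g, ∃ n, g ∈ U (e n) := by
    intro g
    have : g ∈ ⋃ x ∈ t, U x := by rw [htU]; trivial
    simp only [Set.mem_iUnion] at this
    obtain ⟨x, hx, hg⟩ := this
    rw [he] at hx
    obtain ⟨n, rfl⟩ := hx
    exact ⟨n, hg⟩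
  refine ⟨fun g => s (e (Nat.find (hcov g))) g, ?_, fun g => hsj _ _⟩
  rw [continuous_iff_continuousAt]
  intro g
  have h1 : ContinuousAt (s (e (Nat.find (hcov g)))) g :=
    (hs _).continuousAt ((hU _).isOpen.mem_nhds (Nat.find_spec (hcov g)))
  refine h1.congr ?_
  have h2 : ∀ᶠ x in nhds g, ∀ m ∈ Finset.range (Nat.find (hcov g)), x ∉ U (e m) := by
    rw [Filter.eventually_all_finset]
    intro m hm
    exact (hU (e m)).compl.isOpen.mem_nhds (Nat.find_min (hcov g) (Finset.mem_range.1 hm))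
  filter_upwards [(hU _).isOpen.mem_nhds (Nat.find_spec (hcov g)), h2] with x hx hx2
  have : Nat.find (hcov x) = Nat.find (hcov g) :=
    (Nat.find_eq_iff _).2 ⟨hx, fun m hm => hx2 m (Finset.mem_range.2 hm)⟩
  rw [this]
end

section
/- Let G⁽⁰⁾×𝕋 →ᶦ Σ →ʲ G be a twist over an étale locally compact Hausdorff groupoid G, let u ∈ G⁽⁰⁾ and set Σᵤ := {σ ∈ Σ : d(σ) = u}. Then every continuous compactly supported function f : Σᵤ → ℂ satisfying f(z·σ) = z·f(σ) for all z ∈ 𝕋 and σ ∈ Σᵤ extends to a continuous compactly supported function f̃ : Σ → ℂ satisfying f̃(z·σ) = z·f̃(σ) for all z ∈ 𝕋, σ ∈ Σ. In particular the restriction map C_c(G;Σ) → {f ∈ C_c(Σᵤ) : f(z·σ) = z·f(σ)} is surjective. -/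
set_option autoImplicit false

namespace TwistAux

open Topology MeasureTheory

/-- Tietze extension for compactly supported functions on a closed set. -/
theorem tietze_compact {X : Type*} [TopologicalSpace X] [LocallyCompactSpace X] [T2Space X]
    (A : Set X) (hA : IsClosed A) (f : ↥A → ℂ) (hf : Continuous f) (hfs : HasCompactSupport f) :
    ∃ F : X → ℂ, Continuous F ∧ HasCompactSupport F ∧ ∀ (x : X) (hx : x ∈ A), F x = f ⟨x, hx⟩ := by
  classical
  have hK : IsCompact (Subtype.val '' tsupport f) := IsCompact.image hfs continuous_subtype_val
  obtain ⟨L, hL, hKL⟩ := exists_compact_superset hK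
  have hcl : IsCompact (closure (interior L)) :=
    hL.of_isClosed_subset isClosed_closure (closure_minimal interior_subset hL.isClosed)
  obtain ⟨χ, hχ1, hχ2, -⟩ := exists_tsupport_one_of_isOpen_isClosed isOpen_interior hcl
    hK.isClosed hKL
  have : CompactSpace L := isCompact_iff_compactSpace.mp hL
  obtain ⟨g, hg⟩ := ContinuousMap.exists_restrict_eq (X := L) (Y := ℂ)
    (s := Subtype.val ⁻¹' A) (hA.preimage continuous_subtype_val)
    ⟨fun y => f ⟨y.1.1, y.2⟩, by fun_prop⟩
  have hg' : ∀ (x : X) (hx : x ∈ A) (hxL : x ∈ L), g ⟨x, hxL⟩ = f ⟨x, hx⟩ := by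
    intro x hx hxL
    have := DFunLike.congr_fun hg ⟨⟨x, hxL⟩, hx⟩
    simpa using this
  let F : X → ℂ := fun x => if h : x ∈ L then (χ x : ℂ) * g ⟨x, h⟩ else 0
  have hF0 : ∀ x, χ x = 0 → F x = 0 := by
    intro x hx
    simp [F, hx]
  refine ⟨F, ?_, ?_, ?_⟩
  · rw [continuous_iff_continuousAt]
    intro x
    by_cases hx : x ∈ tsupport χ
    · have hxi := hχ1 hx
      have hon : ContinuousOn F L := by
        rw [continuousOn_iff_continuous_domRestrict]
        have : L.domRestrict F = fun y : L => (χ y : ℂ) * g y := by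
          ext y
          simp [F, Set.domRestrict_apply]
        rw [this]
        fun_prop
      exact hon.continuousAt (mem_interior_iff_mem_nhds.mp hxi)
    · have : F =ᶠ[𝓝 x] fun _ => 0 := by
        filter_upwards [(isClosed_tsupport χ).isOpen_compl.mem_nhds hx] with y hy
        exact hF0 y (image_eq_zero_of_notMem_tsupport hy)
      exact continuousAt_const.congr this.symm
  · refine HasCompactSupport.intro hL ?_
    intro x hx
    simp [F, hx]
  · intro x hx
    by_cases hxK : (⟨x, hx⟩ : A) ∈ tsupport f
    · have hxK' : x ∈ Subtype.val '' tsupport f := ⟨_, hxK, rfl⟩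
      have hxL : x ∈ L := interior_subset (hKL hxK')
      have h1 : χ x = 1 := hχ2 hxK'
      simp [F, hxL, h1, hg' x hx hxL]
    · rw [image_eq_zero_of_notMem_tsupport hxK]
      by_cases hxL : x ∈ L
      · simp [F, hxL, hg' x hx hxL, image_eq_zero_of_notMem_tsupport hxK]
      · simp [F, hxL]

/-- Averaging over the circle. -/
theorem average {X : Type*} [TopologicalSpace X] [T2Space X] (act : Circle → X → X)
    (hact : Continuous fun p : Circle × X => act p.1 p.2)
    (hmul : ∀ z w x, act z (act w x) = act (z * w) x)
    (hone : ∀ x, act 1 x = x)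
    (A : Set X) (f : X → ℂ) (hf : Continuous f) (hfs : HasCompactSupport f)
    (hfA : ∀ x ∈ A, ∀ z, f (act z x) = (z : ℂ) * f x) :
    ∃ F : X → ℂ, Continuous F ∧ HasCompactSupport F ∧
      (∀ (z : Circle) (x : X), F (act z x) = (z : ℂ) * F x) ∧ ∀ x ∈ A, F x = f x := by
  let : MeasurableSpace Circle := borel Circle
  have : BorelSpace Circle := ⟨rfl⟩
  let μ : Measure Circle := Measure.haarMeasure ⊤
  have hμ : μ Set.univ = 1 := Measure.haarMeasure_self
  have : IsProbabilityMeasure μ := ⟨hμ⟩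
  refine ⟨fun x => ∫ z, ((z⁻¹ : Circle) : ℂ) * f (act z x) ∂μ, ?_, ?_, ?_, ?_⟩
  · rw [← continuousOn_univ]
    apply continuousOn_integral_of_compact_support (k := Set.univ) isCompact_univ
    · apply Continuous.continuousOn
      have h1 : Continuous fun p : X × Circle => f (act p.2 p.1) :=
        hf.comp (hact.comp continuous_swap)
      have h2 : Continuous fun p : X × Circle => ((p.2⁻¹ : Circle) : ℂ) :=
        continuous_subtype_val.comp (continuous_snd.inv (G := Circle))
      exact h2.mul h1
    · intro p x _ hx
      exact absurd (Set.mem_univ x) hx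
  · refine HasCompactSupport.intro
      ((isCompact_univ (X := Circle)).prod hfs |>.image hact) ?_
    intro x hx
    have : ∀ z, f (act z x) = 0 := by
      intro z
      apply image_eq_zero_of_notMem_tsupport
      intro hz
      apply hx
      refine ⟨(z⁻¹, act z x), ⟨Set.mem_univ _, hz⟩, ?_⟩
      simp [hmul, hone]
    simp [this]
  · intro w x
    have h := integral_mul_right_eq_self (μ := μ)
      (fun z : Circle => (w : ℂ) * (((z⁻¹ : Circle) : ℂ) * f (act z x))) w
    have h' : ∫ z, (w : ℂ) * (((z⁻¹ : Circle) : ℂ) * f (act z x)) ∂μ =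
        (w : ℂ) * ∫ z, ((z⁻¹ : Circle) : ℂ) * f (act z x) ∂μ := integral_const_mul _ _
    refine Eq.trans ?_ (h.trans h')
    refine integral_congr_ae (Filter.Eventually.of_forall fun z => ?_)
    change ((z⁻¹ : Circle) : ℂ) * f (act z (act w x)) =
      (w : ℂ) * ((((z * w)⁻¹ : Circle) : ℂ) * f (act (z * w) x))
    have : (w : ℂ) ≠ 0 := Circle.coe_ne_zero w
    rw [hmul, mul_inv_rev, Circle.coe_mul, Circle.coe_inv w]
    field_simp
  · intro x hx
    have : ∀ z : Circle, ((z⁻¹ : Circle) : ℂ) * f (act z x) = f x := by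
      intro z
      have : (z : ℂ) ≠ 0 := Circle.coe_ne_zero z
      rw [hfA x hx, Circle.coe_inv]
      field_simp
    simp only [this]
    simp

section
variable {G Sg : Type*} [TopologicalSpace G] [TopologicalSpace Sg]
  {SG : TopGroupoid G} {SS : TopGroupoid Sg} (T : Twist SG SS)

theorem continuous_r (S : TopGroupoid G) : Continuous S.r :=
  S.continuous_mul.comp_continuous (continuous_id.prodMk S.continuous_inv) S.comp_inv'

theorem continuous_d (S : TopGroupoid G) : Continuous S.d := by
  refine S.continuous_mul.comp_continuous (S.continuous_inv.prodMk continuous_id) ?_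
  intro g
  have := S.comp_inv' (S.inv g)
  rwa [S.inv_inv'] at this

theorem r_mul_self (S : TopGroupoid G) (g : G) : S.mul (S.r g) g = g := by
  have := S.mul_inv_cancel' (S.comp_inv' g)
  rwa [S.inv_inv'] at this

theorem continuous_smul : Continuous fun p : Circle × Sg => T.smul p.1 p.2 := by
  have h : Continuous fun p : Circle × Sg =>
      ((⟨T.j (SS.r p.2), T.j_r_unit p.2⟩, p.1) : ↥SG.unitSet × Circle) :=
    (Continuous.subtype_mk (T.continuous_j.comp ((continuous_r SS).comp continuous_snd)) _).prodMk
      continuous_fst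
  exact SS.continuous_mul.comp_continuous ((T.continuous_i.comp h).prodMk continuous_snd)
    fun p => (T.comp_central p.2 p.1).1

theorem j_r (σ : Sg) : T.j (SS.r σ) = SG.r (T.j σ) := by
  unfold TopGroupoid.r
  rw [T.j_mul (SS.comp_inv' σ), T.j_inv]

theorem j_smul (z : Circle) (σ : Sg) : T.j (T.smul z σ) = T.j σ := by
  unfold Twist.smul
  rw [T.j_mul (T.comp_central σ z).1, T.j_i]
  change SG.mul (T.j (SS.r σ)) (T.j σ) = T.j σ
  rw [j_r, r_mul_self]

theorem smul_smul (z w : Circle) (σ : Sg) : T.smul z (T.smul w σ) = T.smul (z * w) σ := by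
  have hu : (⟨T.j (SS.r (T.smul w σ)), T.j_r_unit (T.smul w σ)⟩ : ↥SG.unitSet) =
      ⟨T.j (SS.r σ), T.j_r_unit σ⟩ := by
    apply Subtype.ext
    change T.j (SS.r (T.smul w σ)) = T.j (SS.r σ)
    rw [j_r, j_r, j_smul]
  have h1 : T.smul z (T.smul w σ) =
      SS.mul (T.i (⟨T.j (SS.r σ), T.j_r_unit σ⟩, z)) (T.smul w σ) := by
    rw [← hu]; rfl
  rw [h1]
  unfold Twist.smul
  rw [← SS.mul_assoc' (T.i_comp _ z w) (T.comp_central σ w).1, T.i_mul]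

theorem one_smul (σ : Sg) : T.smul 1 σ = σ := by
  have h1 : T.smul 1 (T.smul 1 σ) = T.smul 1 σ := by rw [smul_smul, mul_one]
  have hu : (⟨T.j (SS.r (T.smul 1 σ)), T.j_r_unit (T.smul 1 σ)⟩ : ↥SG.unitSet) =
      ⟨T.j (SS.r σ), T.j_r_unit σ⟩ := by
    apply Subtype.ext
    change T.j (SS.r (T.smul 1 σ)) = T.j (SS.r σ)
    rw [j_r, j_r, j_smul]
  -- cancel `i (r σ, 1)` on the left
  have h2 := SS.inv_mul_cancel' (T.comp_central σ 1).1
  rw [T.i_inv, inv_one] at h2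
  change SS.mul _ (T.smul 1 σ) = σ at h2
  rw [← hu] at h2
  exact h1.symm.trans h2

end

end TwistAux

/-- Let `Σ` be a twist over an étale locally compact Hausdorff groupoid `G`,
`u ∈ G⁽⁰⁾`, and `Σᵤ = {σ ∈ Σ : d(σ) = u}` (identifying `Σ⁽⁰⁾` with `G⁽⁰⁾` via `j`). Every
continuous compactly supported `𝕋`-equivariant function `f : Σᵤ → ℂ` extends to a continuous
compactly supported `𝕋`-equivariant function on all of `Σ`; in particular the restriction map
`C_c(G;Σ) → {f ∈ C_c(Σᵤ) : f(z·σ) = z f(σ)}` is surjective. -/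
theorem equivariant_extension_from_fibre {G Sg : Type*} [TopologicalSpace G]
    [LocallyCompactSpace G] [T2Space G] [TopologicalSpace Sg] [LocallyCompactSpace Sg]
    [T2Space Sg] (SG : TopGroupoid G) (hG : SG.IsEtale) (SS : TopGroupoid Sg)
    (T : Twist SG SS) (u : G) (hu : u ∈ SG.unitSet)
    (Su : Set Sg) (hSu : Su = {σ : Sg | T.j (SS.d σ) = u})
    (hSuInv : ∀ σ ∈ Su, ∀ z : Circle, T.smul z σ ∈ Su)
    (f : ↥Su → ℂ) (hfcont : Continuous f) (hfsupp : HasCompactSupport f)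
    (hfequiv : ∀ (σ : Sg) (hσ : σ ∈ Su) (z : Circle),
      f ⟨T.smul z σ, hSuInv σ hσ z⟩ = (z : ℂ) * f ⟨σ, hσ⟩) :
    ∃ F : Sg → ℂ, Continuous F ∧ HasCompactSupport F ∧
      (∀ (z : Circle) (σ : Sg), F (T.smul z σ) = (z : ℂ) * F σ) ∧
      ∀ (σ : Sg) (hσ : σ ∈ Su), F σ = f ⟨σ, hσ⟩ := by
  have hcl : IsClosed Su := by
    rw [hSu]
    exact isClosed_eq (T.continuous_j.comp (TwistAux.continuous_d SS)) continuous_const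
  obtain ⟨F₀, hF₀, hF₀s, hF₀e⟩ := TwistAux.tietze_compact Su hcl f hfcont hfsupp
  obtain ⟨F, hF, hFs, hFe, hFA⟩ := TwistAux.average T.smul (TwistAux.continuous_smul T)
    (TwistAux.smul_smul T) (TwistAux.one_smul T) Su F₀ hF₀ hF₀s (by
      intro σ hσ z
      rw [hF₀e _ (hSuInv σ hσ z), hF₀e _ hσ, hfequiv])
  exact ⟨F, hF, hFs, hFe, fun σ hσ => (hFA σ hσ).trans (hF₀e σ hσ)⟩
end

section
/- Let E be a commutative idempotent semigroup (semilattice) with a zero element 0 (0e = e0 = 0 for all e ∈ E). A character on E is a nonzero map χ : E → {0,1} with χ(ef) = χ(e)χ(f) for all e,f ∈ E and χ(0) = 0. Then the set Ê of all characters, equipped with the topology inherited from the product topology on {0,1}^E ({0,1} discrete), is a locally compact, totally disconnected, Hausdorff topological space, and for each e ∈ E the set D_e := {χ ∈ Ê : χ(e) = 1} is a compact open subset of Ê. -/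
set_option autoImplicit false

/-- The set of characters of a semilattice `E` with zero element `z`: nonzero multiplicative
maps `χ : E → {0,1}` with `χ(z) = 0`, encoded as Boolean-valued functions (`false ↔ 0`,
`true ↔ 1`, with `&&` as multiplication on `{0,1}`). -/
def charSet (E : Type*) [CommSemigroup E] (z : E) : Set (E → Bool) :=
  {χ | (∀ e f : E, χ (e * f) = (χ e && χ f)) ∧ χ z = false ∧ ∃ e : E, χ e = true}

/-- Let `E` be a commutative idempotent semigroup (semilattice) with a zero
element. The set `Ê` of characters of `E`, with the topology inherited from the product
topology on `{0,1}^E` (`{0,1}` discrete), is a locally compact, totally disconnected,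
Hausdorff space, and for each `e ∈ E` the set `D_e = {χ ∈ Ê : χ(e) = 1}` is compact and open
in `Ê`. -/
theorem character_space_of_semilattice (E : Type*) [CommSemigroup E]
    (hidem : ∀ e : E, e * e = e) (z : E) (hzero : ∀ e : E, z * e = z) :
    LocallyCompactSpace ↥(charSet E z) ∧
    TotallyDisconnectedSpace ↥(charSet E z) ∧
    T2Space ↥(charSet E z) ∧
    ∀ e : E, IsCompact {χ : ↥(charSet E z) | (χ : E → Bool) e = true} ∧
      IsOpen {χ : ↥(charSet E z) | (χ : E → Bool) e = true} := by
  have key : ∀ e : E, IsCompact {χ : ↥(charSet E z) | (χ : E → Bool) e = true} ∧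
      IsOpen {χ : ↥(charSet E z) | (χ : E → Bool) e = true} := by
    intro e
    constructor
    · rw [Topology.IsInducing.subtypeVal.isCompact_iff]
      apply IsClosed.isCompact
      have himg : (Subtype.val '' {χ : ↥(charSet E z) | (χ : E → Bool) e = true}) =
          (⋂ a : E, ⋂ b : E, {χ : E → Bool | χ (a * b) = (χ a && χ b)}) ∩
            ({χ : E → Bool | χ z = false} ∩ {χ : E → Bool | χ e = true}) := by
        ext χ
        simp only [Set.mem_image, Set.mem_ofPred_eq, Set.mem_inter_iff, Set.mem_iInter]
        constructor
        · rintro ⟨⟨ψ, h1, h2, h3⟩, h4, rfl⟩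
          exact ⟨h1, h2, h4⟩
        · rintro ⟨h1, h2, h3⟩
          exact ⟨⟨χ, h1, h2, e, h3⟩, h3, rfl⟩
      rw [himg]
      refine IsClosed.inter (isClosed_iInter fun a => isClosed_iInter fun b => ?_)
        (IsClosed.inter ?_ ?_)
      · refine isClosed_eq (continuous_apply _) ?_
        have hc : Continuous (fun χ : E → Bool => (χ a, χ b)) :=
          (continuous_apply a).prodMk (continuous_apply b)
        have hd : Continuous (fun p : Bool × Bool => (p.1 && p.2)) :=
          continuous_of_discreteTopology
        exact hd.comp hc
      · exact isClosed_eq (continuous_apply _) continuous_const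
      · exact isClosed_eq (continuous_apply _) continuous_const
    · have hc : Continuous (fun χ : ↥(charSet E z) => (χ : E → Bool) e) :=
        (continuous_apply e).comp continuous_subtype_val
      exact (isOpen_discrete ({true} : Set Bool)).preimage hc
  have hw : WeaklyLocallyCompactSpace ↥(charSet E z) := by
    refine ⟨fun χ => ?_⟩
    obtain ⟨e, he⟩ := χ.2.2.2
    exact ⟨_, (key e).1, (key e).2.mem_nhds he⟩
  exact ⟨inferInstance, inferInstance, inferInstance, key⟩
end
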